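/- arXiv:1601.01062 — 5 statements merged into one kernel-verified Lean document; each statement's English description precedes it below -/
import Mathlib

section
/- Let A be an algebra with a stratifying system indexed by a finite quasi-poset Λ. Then for all λ, μ ∈ Λ, if Ext^1_A(Δ(λ), Δ(μ)) ≠ 0 then λ < μ (i.e., λ ≤ μ and not μ ≤ λ). -/
open CategoryTheory

/-- Strict inequality `λ < μ` in a quasi-poset: `λ ≤ μ` and not `μ ≤ λ`. -/
def QLt {Λ : Type} (le : Λ → Λ → Prop) (a b : Λ) : Prop := le a b ∧ ¬ le b a

/-- The section `q/p` associated to two submodules `p, q` of a module: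
the quotient of `q` by `p ∩ q` (intended to be used when `p ≤ q`). -/
abbrev SubSection {A M : Type} [Ring A] [AddCommGroup M] [Module A M]
    (p q : Submodule A M) : Type := ↥q ⧸ (p.comap q.subtype)

/-- If `0 → K → P → X → 0` is short exact with `P` projective and there is no nonzero morphism
`K ⟶ Y`, then every `1`-cocycle of a projective resolution of `X` with values in `Y` is a
coboundary. -/
theorem exists_d_comp_eq_of_shortExact {C : Type*} [Category* C] [Abelian C]
    {S : ShortComplex C} (hS : S.ShortExact) [Projective S.X₂] {Y : C}
    (hY : ∀ f : S.X₁ ⟶ Y, f = 0) (R : ProjectiveResolution S.X₃)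
    (f : R.complex.X 1 ⟶ Y) (hf : R.complex.d 2 1 ≫ f = 0) :
    ∃ g : R.complex.X 0 ⟶ Y, R.complex.d 1 0 ≫ g = f := by
  have := hS.mono_f
  have := hS.epi_g
  let p : R.complex.X 0 ⟶ S.X₃ := R.π.f 0
  have hp : R.complex.d 1 0 ≫ p = 0 := R.complex_d_comp_π_f_zero
  have : Epi p := inferInstanceAs (Epi (R.π.f 0))
  have hex : (ShortComplex.mk _ _ hp).Exact := R.exact₀
  let T := ShortComplex.mk _ _ (R.complex.d_comp_d 2 1 0)
  have hT : T.Exact := R.exact_succ 0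
  have : Mono T.fromOpcycles := hT.mono_fromOpcycles
  have hTp : T.fromOpcycles ≫ p = 0 := by
    rw [← cancel_epi T.pOpcycles, T.p_fromOpcycles_assoc, Limits.comp_zero]
    exact hp
  have hTex : (ShortComplex.mk _ _ hTp).Exact := by
    let α : ShortComplex.mk _ _ hp ⟶ ShortComplex.mk _ _ hTp :=
      { τ₁ := T.pOpcycles
        τ₂ := 𝟙 _
        τ₃ := 𝟙 _
        comm₁₂ := (T.p_fromOpcycles).trans (Category.comp_id _).symm
        comm₂₃ := (Category.id_comp p).trans (Category.comp_id p).symm }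
    have : Epi α.τ₁ := inferInstanceAs (Epi T.pOpcycles)
    have : IsIso α.τ₂ := inferInstanceAs (IsIso (𝟙 _))
    have : Mono α.τ₃ := inferInstanceAs (Mono (𝟙 _))
    exact (ShortComplex.exact_iff_of_epi_of_isIso_of_mono α).1 hex
  let φ : R.complex.X 0 ⟶ S.X₂ := Projective.factorThru p S.g
  have hφ : φ ≫ S.g = p := Projective.factorThru_comp _ _
  let ψ : S.X₂ ⟶ R.complex.X 0 := Projective.factorThru S.g p
  have hψ : ψ ≫ p = S.g := Projective.factorThru_comp _ _
  obtain ⟨h, hh⟩ : ∃ h : R.complex.X 0 ⟶ R.complex.X 1,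
      h ≫ R.complex.d 1 0 = 𝟙 _ - φ ≫ ψ :=
    ⟨_, hex.liftFromProjective_comp (𝟙 _ - φ ≫ ψ) (by simp [hφ, hψ])⟩
  obtain ⟨k, hk⟩ : ∃ k : R.complex.X 1 ⟶ S.X₁, k ≫ S.f = R.complex.d 1 0 ≫ φ :=
    ⟨_, hS.exact.lift_f (R.complex.d 1 0 ≫ φ) (by simp [hφ, hp])⟩
  obtain ⟨j, hj⟩ : ∃ j : S.X₁ ⟶ T.opcycles, j ≫ T.fromOpcycles = S.f ≫ ψ :=
    have : Mono (ShortComplex.mk _ _ hTp).f := inferInstanceAs (Mono T.fromOpcycles)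
    ⟨_, hTex.lift_f (S.f ≫ ψ) (by simp [hψ])⟩
  have key : (𝟙 _ - R.complex.d 1 0 ≫ h) ≫ T.pOpcycles = k ≫ j := by
    rw [← cancel_mono T.fromOpcycles, Category.assoc, Category.assoc, T.p_fromOpcycles, hj,
      ← Category.assoc k, hk]
    change (𝟙 _ - R.complex.d 1 0 ≫ h) ≫ R.complex.d 1 0 = _
    simp [hh]
  refine ⟨h ≫ f, ?_⟩
  have hz : (𝟙 _ - R.complex.d 1 0 ≫ h) ≫ f = 0 := by
    rw [← T.p_descOpcycles f hf, ← Category.assoc, key, Category.assoc, hY (j ≫ _),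
      Limits.comp_zero]
  rw [Preadditive.sub_comp, Category.id_comp, sub_eq_zero, Category.assoc] at hz
  exact hz.symm

/-- If `0 → K → P → X → 0` is short exact with `P` projective and there is no nonzero morphism
`K ⟶ Y`, then `Ext¹(X, Y)` vanishes. -/
theorem isZero_ext_one_of_shortExact (k : Type*) [Ring k] {C : Type*} [Category* C] [Abelian C]
    [Linear k C] [EnoughProjectives C] {S : ShortComplex C} (hS : S.ShortExact)
    [Projective S.X₂] {Y : C} (hY : ∀ f : S.X₁ ⟶ Y, f = 0) :
    Limits.IsZero (((Ext k C 1).obj (Opposite.op S.X₃)).obj Y) := by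
  let R := projectiveResolution S.X₃
  refine Limits.IsZero.of_iso ?_ (R.isoExt 1 Y)
  rw [← HomologicalComplex.exactAt_iff_isZero_homology,
    HomologicalComplex.exactAt_iff' _ 0 1 2 (by simp) (by simp),
    ShortComplex.moduleCat_exact_iff]
  exact fun f hf ↦ exists_d_comp_eq_of_shortExact hS hY R f hf

/-- A linear map out of a term of a filtration vanishes as soon as all linear maps out of the
sections below it vanish. -/
theorem linearMap_eq_zero_of_filtration {A M N : Type} [Ring A] [AddCommGroup M] [Module A M]
    [AddCommGroup N] [Module A N] {F : ℕ → Submodule A M} (h0 : F 0 = ⊥)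
    (hmono : ∀ i, F i ≤ F (i + 1)) (n : ℕ)
    (hN : ∀ i < n, ∀ f : SubSection (F i) (F (i + 1)) →ₗ[A] N, f = 0) (f : F n →ₗ[A] N) :
    f = 0 := by
  induction n with
  | zero =>
    ext ⟨x, hx⟩
    obtain rfl : x = 0 := by simpa [h0] using hx
    exact f.map_zero
  | succ n ih =>
    have hres := ih (fun i hi ↦ hN i (by omega)) (f ∘ₗ Submodule.inclusion (hmono n))
    have hker : (F n).comap (F (n + 1)).subtype ≤ LinearMap.ker f :=
      fun x hx ↦ LinearMap.congr_fun hres ⟨x, hx⟩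
    rw [← Submodule.liftQ_mkQ _ f hker, hN n n.lt_succ_self (Submodule.liftQ _ f hker),
      LinearMap.zero_comp]

/-- If `P` is a projective module with `P / K` isomorphic to `X`, and there is no nonzero
linear map `K → Y`, then `Ext¹(X, Y)` vanishes. -/
theorem isZero_ext_one_of_subSection {A P X Y : Type} [Ring A] [AddCommGroup P] [Module A P]
    [Module.Projective A P] [AddCommGroup X] [Module A X] [AddCommGroup Y] [Module A Y]
    {K T : Submodule A P} (hT : T = ⊤) (e : SubSection K T ≃ₗ[A] X)
    (hY : ∀ f : K →ₗ[A] Y, f = 0) :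
    Limits.IsZero (((Ext ℤ (ModuleCat A) 1).obj
      (Opposite.op (ModuleCat.of A X))).obj (ModuleCat.of A Y)) := by
  subst hT
  let q : P →ₗ[A] X := e.toLinearMap ∘ₗ Submodule.mkQ _ ∘ₗ Submodule.topEquiv.symm.toLinearMap
  have hq : Function.Surjective q :=
    e.surjective.comp ((Submodule.mkQ_surjective _).comp Submodule.topEquiv.symm.surjective)
  have hker : ∀ x, q x = 0 ↔ x ∈ K := fun x ↦ by simp [q, Submodule.topEquiv]
  let S : ShortComplex (ModuleCat A) := ShortComplex.mk (ModuleCat.ofHom K.subtype)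
    (ModuleCat.ofHom q) (by ext x; exact (hker x).2 x.2)
  have hS : S.ShortExact :=
    { exact := (ShortComplex.moduleCat_exact_iff S).2 fun x hx ↦ ⟨⟨x, (hker x).1 hx⟩, rfl⟩
      mono_f := (ModuleCat.mono_iff_injective _).2 K.subtype_injective
      epi_g := (ModuleCat.epi_iff_surjective _).2 hq }
  have : Projective S.X₂ := (IsProjective.iff_projective P).1 inferInstance
  exact isZero_ext_one_of_shortExact ℤ hS fun f ↦ ModuleCat.hom_ext (hY f.hom)

/-- If `A` is an algebra with a stratifying system indexed by a finite
quasi-poset `Λ`, then `Ext¹_A(Δ(λ), Δ(μ)) ≠ 0` implies `λ < μ`. -/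
theorem ext_ne_zero_implies_lt
    -- the base ring
    (𝒦 : Type) [CommRing 𝒦] [IsNoetherianRing 𝒦]
    -- the algebra
    (A : Type) [Ring A] [Algebra 𝒦 A] [Module.Finite 𝒦 A] [Module.Projective 𝒦 A]
    -- the finite quasi-poset
    (Λ : Type) [Fintype Λ] (le : Λ → Λ → Prop)
    (hrefl : ∀ l, le l l) (htrans : ∀ {a b c}, le a b → le b c → le a c)
    -- the standard modules Δ(λ): finitely generated over A, projective over 𝒦
    (Δ : Λ → Type) [∀ l, AddCommGroup (Δ l)] [∀ l, Module A (Δ l)]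
    [∀ l, Module 𝒦 (Δ l)] [∀ l, IsScalarTower 𝒦 A (Δ l)]
    [∀ l, Module.Finite A (Δ l)] [∀ l, Module.Projective 𝒦 (Δ l)]
    -- the projective modules P(λ)
    (P : Λ → Type) [∀ l, AddCommGroup (P l)] [∀ l, Module A (P l)]
    [∀ l, Module.Finite A (P l)] [∀ l, Module.Projective A (P l)]
    -- the epimorphisms P(λ) ↠ Δ(λ)
    (π : ∀ l, P l →ₗ[A] Δ l) (hπ : ∀ l, Function.Surjective (π l))
    -- (SS1)
    (hSS1 : ∀ l m, (∃ f : P l →ₗ[A] Δ m, f ≠ 0) → le l m)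
    -- (SS2)
    (hSS2 : ∀ (L : Type) [AddCommGroup L] [Module A L], IsSimpleModule A L →
      ∃ (l : Λ) (f : Δ l →ₗ[A] L), Function.Surjective f)
    -- (SS3)
    (hSS3 : ∀ l : Λ, ∃ (n : ℕ) (F : ℕ → Submodule A (P l)) (μ : ℕ → Λ),
      F 0 = ⊥ ∧ F (n + 1) = ⊤ ∧ (∀ i, F i ≤ F (i + 1)) ∧
      Nonempty (SubSection (F n) (F (n + 1)) ≃ₗ[A] Δ l) ∧
      (∀ i < n, QLt le l (μ i) ∧ Nonempty (SubSection (F i) (F (i + 1)) ≃ₗ[A] Δ (μ i))))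
    -- the conclusion
    (l m : Λ)
    (hExt : ∃ e : (((Ext ℤ (ModuleCat A) 1).obj
        (Opposite.op (ModuleCat.of A (Δ l)))).obj (ModuleCat.of A (Δ m))),
      e ≠ 0) :
    QLt le l m := by
  obtain ⟨n, F, μ, h0, htop, hmono, ⟨e⟩, hsec⟩ := hSS3 l
  obtain ⟨x, hx⟩ := hExt
  suffices ∃ i < n, le (μ i) m by
    obtain ⟨i, hi, him⟩ := this
    obtain ⟨⟨hli, hil⟩, -⟩ := hsec i hi
    exact ⟨htrans hli him, fun hml ↦ hil (htrans him hml)⟩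
  by_contra! hle
  have hΔ : ∀ i < n, ∀ f : Δ (μ i) →ₗ[A] Δ m, f = 0 := fun i hi f ↦ by
    by_contra hf
    refine hle i hi (hSS1 _ _ ⟨f ∘ₗ π (μ i), fun h ↦ hf ?_⟩)
    rwa [← LinearMap.cancel_right (hπ (μ i)), LinearMap.zero_comp]
  have hF : ∀ f : F n →ₗ[A] Δ m, f = 0 :=
    linearMap_eq_zero_of_filtration h0 hmono n fun i hi f ↦ by
      obtain ⟨-, ⟨e'⟩⟩ := hsec i hi
      ext x
      simpa using LinearMap.congr_fun (hΔ i hi (f ∘ₗ e'.symm.toLinearMap)) (e' (Submodule.mkQ _ x))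
  have := ModuleCat.subsingleton_of_isZero (isZero_ext_one_of_subSection htop e hF)
  exact hx (Subsingleton.elim _ _)
end

section
/- Let A be an algebra with a stratifying system indexed by a finite quasi-poset Λ and let ht: Λ → ℤ be a height function. Suppose M is an A-module with a submodule D ≅ Δ(ν) such that M/D ≅ Δ(μ), where μ, ν ∈ Λ and ht(ν) ≤ ht(μ). Then M is the direct sum of D and a submodule E with E ≅ Δ(μ) (and M/E ≅ D). -/
/-- If every map between the section `q/p` and `N` vanishes and `g` maps `q` into `N ⊆ M`
and kills `p`, then `g` kills `q`. -/
theorem le_ker_of_section_hom_eq_zero {A X M : Type} [Ring A] [AddCommGroup X] [Module A X]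
    [AddCommGroup M] [Module A M] (N : Submodule A M) (g : X →ₗ[A] M) (p q : Submodule A X)
    (hp : p ≤ LinearMap.ker g) (hq : q ≤ N.comap g)
    (h0 : ∀ h : SubSection p q →ₗ[A] ↥N, h = 0) : q ≤ LinearMap.ker g := by
  let r : ↥q →ₗ[A] ↥N := g.restrict hq
  have hr : p.comap q.subtype ≤ LinearMap.ker r := fun x hx =>
    LinearMap.mem_ker.2 (Subtype.ext (LinearMap.mem_ker.1 (hp hx)))
  intro x hx
  have h := LinearMap.congr_fun (h0 ((p.comap q.subtype).liftQ r hr)) (Submodule.Quotient.mk ⟨x, hx⟩)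
  exact LinearMap.mem_ker.2 (congrArg Subtype.val h)

/-- A section of the quotient map splits off a complement. -/
theorem exists_isCompl_of_section {A M : Type} [Ring A] [AddCommGroup M] [Module A M]
    (D : Submodule A M) (s : (M ⧸ D) →ₗ[A] M) (hs : D.mkQ ∘ₗ s = LinearMap.id) :
    ∃ E : Submodule A M, IsCompl D E ∧ Nonempty (↥E ≃ₗ[A] M ⧸ D) ∧
      Nonempty ((M ⧸ E) ≃ₗ[A] ↥D) := by
  have hs' : ∀ y, D.mkQ (s y) = y := fun y => LinearMap.congr_fun hs y
  have hc : IsCompl D (LinearMap.range s) := by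
    refine IsCompl.of_eq ?_ ?_
    · refine (Submodule.eq_bot_iff _).2 ?_
      rintro _ ⟨hx, y, rfl⟩
      have hy : D.mkQ (s y) = 0 := (Submodule.Quotient.mk_eq_zero D).2 hx
      rw [hs'] at hy
      rw [hy, map_zero]
    · refine Submodule.eq_top_iff'.2 fun x => Submodule.mem_sup.2
        ⟨x - s (D.mkQ x), ?_, s (D.mkQ x), ⟨_, rfl⟩, sub_add_cancel _ _⟩
      refine (Submodule.Quotient.mk_eq_zero D).1 ?_
      change D.mkQ (x - s (D.mkQ x)) = 0
      rw [map_sub, hs', sub_self]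
  exact ⟨_, hc, ⟨(Submodule.quotientEquivOfIsCompl D _ hc).symm⟩,
    ⟨Submodule.quotientEquivOfIsCompl _ D hc.symm⟩⟩

/-- If `q : X → M ⧸ D` is surjective with `X` projective and every lift of `q` to `M` kills
`ker q`, then the quotient map `M → M ⧸ D` has a section. -/
theorem exists_section_of_ker_le {A X M : Type} [Ring A] [AddCommGroup X] [Module A X]
    [Module.Projective A X] [AddCommGroup M] [Module A M] (D : Submodule A M)
    (q : X →ₗ[A] M ⧸ D) (hq : Function.Surjective q)
    (hker : ∀ g : X →ₗ[A] M, D.mkQ ∘ₗ g = q → LinearMap.ker q ≤ LinearMap.ker g) :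
    ∃ s : (M ⧸ D) →ₗ[A] M, D.mkQ ∘ₗ s = LinearMap.id := by
  obtain ⟨g, hg⟩ := Module.projective_lifting_property D.mkQ q D.mkQ_surjective
  let e := q.quotKerEquivOfSurjective hq
  refine ⟨(LinearMap.ker q).liftQ g (hker g hg) ∘ₗ e.symm.toLinearMap, LinearMap.ext fun y => ?_⟩
  obtain ⟨x, rfl⟩ := hq y
  have hx : e.symm (q x) = Submodule.Quotient.mk x := (LinearEquiv.symm_apply_eq e).2 rfl
  simpa [hx] using LinearMap.congr_fun hg x

/-- Given a stratifying system for `A` and a height function `ht` on `Λ`,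
if `M` has a submodule `D ≅ Δ(ν)` with `M/D ≅ Δ(μ)` and `ht ν ≤ ht μ`, then `M` is a direct
sum of `D` and a submodule `E ≅ Δ(μ)`, and `M/E ≅ D`. -/
theorem exchange_of_height_le
    (𝒦 : Type) [CommRing 𝒦] [IsNoetherianRing 𝒦]
    (A : Type) [Ring A] [Algebra 𝒦 A] [Module.Finite 𝒦 A] [Module.Projective 𝒦 A]
    (Λ : Type) [Fintype Λ] (le : Λ → Λ → Prop)
    (hrefl : ∀ l, le l l) (htrans : ∀ {a b c}, le a b → le b c → le a c)
    (Δ : Λ → Type) [∀ l, AddCommGroup (Δ l)] [∀ l, Module A (Δ l)]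
    [∀ l, Module 𝒦 (Δ l)] [∀ l, IsScalarTower 𝒦 A (Δ l)]
    [∀ l, Module.Finite A (Δ l)] [∀ l, Module.Projective 𝒦 (Δ l)]
    (P : Λ → Type) [∀ l, AddCommGroup (P l)] [∀ l, Module A (P l)]
    [∀ l, Module.Finite A (P l)] [∀ l, Module.Projective A (P l)]
    (π : ∀ l, P l →ₗ[A] Δ l) (hπ : ∀ l, Function.Surjective (π l))
    (hSS1 : ∀ l m, (∃ f : P l →ₗ[A] Δ m, f ≠ 0) → le l m)
    (hSS2 : ∀ (L : Type) [AddCommGroup L] [Module A L], IsSimpleModule A L →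
      ∃ (l : Λ) (f : Δ l →ₗ[A] L), Function.Surjective f)
    (hSS3 : ∀ l : Λ, ∃ (n : ℕ) (F : ℕ → Submodule A (P l)) (μ : ℕ → Λ),
      F 0 = ⊥ ∧ F (n + 1) = ⊤ ∧ (∀ i, F i ≤ F (i + 1)) ∧
      Nonempty (SubSection (F n) (F (n + 1)) ≃ₗ[A] Δ l) ∧
      (∀ i < n, QLt le l (μ i) ∧ Nonempty (SubSection (F i) (F (i + 1)) ≃ₗ[A] Δ (μ i))))
    -- the height function
    (ht : Λ → ℤ)
    (hht_lt : ∀ {a b}, QLt le a b → ht a < ht b)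
    (hht_sim : ∀ {a b}, le a b → le b a → ht a = ht b)
    -- the module M with a submodule D ≅ Δ(ν) and M/D ≅ Δ(μ), ht ν ≤ ht μ
    (μ ν : Λ)
    (M : Type) [AddCommGroup M] [Module A M] [Module.Finite A M]
    (D : Submodule A M)
    (eD : ↥D ≃ₗ[A] Δ ν) (eQ : (M ⧸ D) ≃ₗ[A] Δ μ)
    (hhtle : ht ν ≤ ht μ) :
    ∃ E : Submodule A M, IsCompl D E ∧ Nonempty (↥E ≃ₗ[A] Δ μ) ∧
      Nonempty ((M ⧸ E) ≃ₗ[A] ↥D) := by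
  have hΔ : ∀ l, QLt le μ l → ∀ h : Δ l →ₗ[A] Δ ν, h = 0 := by
    intro l hl h
    by_contra hne
    have hle : le l ν := hSS1 l ν ⟨h ∘ₗ π l, fun h0 => hne <|
      (LinearMap.cancel_right (hπ l)).1 (h0.trans (LinearMap.zero_comp _).symm)⟩
    have hlν : ht l ≤ ht ν := by
      by_cases hge : le ν l
      · exact (hht_sim hle hge).le
      · exact (hht_lt ⟨hle, hge⟩).le
    exact absurd (hht_lt hl) (not_lt.2 (hlν.trans hhtle))
  obtain ⟨n, F, m, hF0, hFtop, hFmono, ⟨e⟩, hsec⟩ := hSS3 μ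
  let t : P μ →ₗ[A] ↥(F (n + 1)) := LinearMap.id.codRestrict _ fun x => hFtop ▸ Submodule.mem_top
  let q : P μ →ₗ[A] M ⧸ D :=
    (e ≪≫ₗ eQ.symm).toLinearMap ∘ₗ ((F n).comap (F (n + 1)).subtype).mkQ ∘ₗ t
  have hqs : Function.Surjective q :=
    (e ≪≫ₗ eQ.symm).surjective.comp ((Submodule.mkQ_surjective _).comp fun y => ⟨y, rfl⟩)
  have hqker : LinearMap.ker q = F n := by
    ext x
    simp [q, t]
  obtain ⟨s, hs⟩ := exists_section_of_ker_le D q hqs fun g hg => by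
    rw [hqker]
    have hFD : F n ≤ D.comap g := fun x hx => (Submodule.Quotient.mk_eq_zero D).1 <|
      (LinearMap.congr_fun hg x).trans (LinearMap.mem_ker.1 (hqker ▸ hx))
    have hkill : ∀ i ≤ n, F i ≤ LinearMap.ker g := by
      intro i
      induction i with
      | zero => exact fun _ => hF0 ▸ bot_le
      | succ i ih =>
        intro hi
        obtain ⟨hlt, ⟨e'⟩⟩ := hsec i hi
        refine le_ker_of_section_hom_eq_zero D g (F i) (F (i + 1)) (ih (Nat.le_of_succ_le hi))
          ((monotone_nat_of_le_succ hFmono hi).trans hFD) fun h => ?_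
        have h0 := hΔ _ hlt (eD.toLinearMap ∘ₗ h ∘ₗ e'.symm.toLinearMap)
        refine LinearMap.ext fun x => ?_
        simpa using LinearMap.congr_fun h0 (e' x)
    exact hkill n le_rfl
  obtain ⟨E, hE, ⟨e₁⟩, he₂⟩ := exists_isCompl_of_section D s hs
  exact ⟨E, hE, ⟨e₁ ≪≫ₗ eQ⟩, he₂⟩
end

section
/- Let A be an algebra with a stratifying system indexed by a finite quasi-poset Λ and let ht: Λ → ℤ be a height function. For λ ∈ Λ and j ∈ ℤ set P(λ)_j = trace_{P(λ)}(⊕_{μ: ht(μ) ≥ j} P(μ)). Then P(λ)_{j+1} ⊆ P(λ)_j for all j, and each quotient P(λ)_j / P(λ)_{j+1} is isomorphic to a direct sum of modules Δ(μ) with ht(μ) = j. -/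
open DirectSum

/-- The trace of a module `Y` in a module `X`: the submodule of `X` generated by the
images of all `A`-homomorphisms `Y → X`. -/
def traceModule {A Y X : Type} [Ring A] [AddCommGroup Y] [Module A Y]
    [AddCommGroup X] [Module A X] : Submodule A X :=
  ⨆ f : Y →ₗ[A] X, LinearMap.range f

section DeltaFiltration

variable (A : Type) {Λ : Type} [Ring A] (Δ : Λ → Type) [∀ l, AddCommGroup (Δ l)] [∀ l, Module A (Δ l)]

/-- `DeltaFiltered A Δ S M` says that `M` has a finite filtration all of whose sections are
isomorphic to modules `Δ ν` with `ν ∈ S`. -/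
inductive DeltaFiltered (S : Set Λ) : ∀ (M : Type) [AddCommGroup M] [Module A M], Prop
  | zero (M : Type) [AddCommGroup M] [Module A M] (h : Subsingleton M) : DeltaFiltered S M
  | extension (N M : Type) [AddCommGroup N] [Module A N] [AddCommGroup M] [Module A M]
      (ν : Λ) (hν : ν ∈ S) (f : N →ₗ[A] M) (g : M →ₗ[A] Δ ν)
      (hf : Function.Injective f) (hfg : Function.Exact f g) (hg : Function.Surjective g)
      (hN : DeltaFiltered S N) : DeltaFiltered S M

variable {A} {Δ} {S : Set Λ}

namespace DeltaFiltered

theorem of_equiv {M M' : Type} [AddCommGroup M] [Module A M] [AddCommGroup M'] [Module A M']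
    (h : DeltaFiltered A Δ S M) (e : M ≃ₗ[A] M') : DeltaFiltered A Δ S M' := by
  cases h with
  | zero _ h => exact .zero _ e.symm.toEquiv.subsingleton
  | extension N _ ν hν f g hf hfg hg hN =>
    refine .extension N M' ν hν (e.toLinearMap ∘ₗ f) (g ∘ₗ e.symm.toLinearMap)
      (e.injective.comp hf) (fun y => ?_) (hg.comp e.symm.surjective) hN
    simp only [LinearMap.comp_apply, LinearEquiv.coe_coe, hfg (e.symm y), Set.mem_range]
    simp only [← e.symm_apply_eq, eq_comm]

theorem of_filtration {P : Type} [AddCommGroup P] [Module A P] {n : ℕ} {F : ℕ → Submodule A P}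
    {μ : ℕ → Λ} (h0 : F 0 = ⊥) (hmono : ∀ i, F i ≤ F (i + 1))
    (hsec : ∀ i < n, μ i ∈ S ∧ Nonempty (SubSection (F i) (F (i + 1)) ≃ₗ[A] Δ (μ i))) :
    DeltaFiltered A Δ S (F n) := by
  induction n with
  | zero => exact .zero _ (by rw [h0]; infer_instance)
  | succ n ih =>
    obtain ⟨hμ, ⟨e⟩⟩ := hsec n n.lt_succ_self
    refine .extension (F n) (F (n + 1)) (μ n) hμ (Submodule.inclusion (hmono n))
      (e.toLinearMap ∘ₗ Submodule.mkQ _) (Submodule.inclusion_injective _) (fun y => ?_)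
      (e.surjective.comp (Submodule.mkQ_surjective _))
      (ih fun i hi => hsec i (hi.trans n.lt_succ_self))
    simp only [LinearMap.comp_apply, LinearEquiv.coe_coe, map_eq_zero_iff e e.injective,
      Submodule.mkQ_apply, Submodule.Quotient.mk_eq_zero, Submodule.mem_comap]
    exact ⟨fun hy => ⟨⟨y, hy⟩, rfl⟩, by rintro ⟨x, rfl⟩; exact x.2⟩

theorem hom_to_eq_zero {N X : Type} [AddCommGroup N] [Module A N] [AddCommGroup X] [Module A X]
    (h : DeltaFiltered A Δ S N) (hX : ∀ ν ∈ S, ∀ f : X →ₗ[A] Δ ν, f = 0) (f : X →ₗ[A] N) :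
    f = 0 := by
  induction h with
  | zero _ h => ext x; exact Subsingleton.elim _ _
  | extension N M ν hν i g hi hig hg hN ih =>
    have hr : LinearMap.range f ≤ LinearMap.range i := by
      rintro _ ⟨x, rfl⟩
      exact (hig _).1 (LinearMap.congr_fun (hX ν hν (g ∘ₗ f)) x)
    ext x
    obtain ⟨e, he⟩ : ∃ e : X →ₗ[A] N, i ∘ₗ e = f := by
      refine ⟨(LinearEquiv.ofInjective i hi).symm.toLinearMap ∘ₗ
        f.codRestrict _ (fun x => hr ⟨x, rfl⟩), ?_⟩
      ext x
      exact congrArg Subtype.val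
        ((LinearEquiv.ofInjective i hi).apply_symm_apply ⟨f x, hr ⟨x, rfl⟩⟩)
    rw [← he, ih e]
    simp

theorem hom_from_eq_zero {N X : Type} [AddCommGroup N] [Module A N] [AddCommGroup X] [Module A X]
    (h : DeltaFiltered A Δ S N) (hX : ∀ ν ∈ S, ∀ f : Δ ν →ₗ[A] X, f = 0) (f : N →ₗ[A] X) :
    f = 0 := by
  induction h with
  | zero _ h => ext x; rw [Subsingleton.elim x 0]; simp
  | extension N M ν hν i g hi hig hg hN ih =>
    have hk : LinearMap.ker g ≤ LinearMap.ker f := by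
      intro x hx
      obtain ⟨y, rfl⟩ := (hig _).1 hx
      exact LinearMap.congr_fun (ih (f ∘ₗ i)) y
    have h0 := hX ν hν ((LinearMap.ker g).liftQ f hk ∘ₗ
      (g.quotKerEquivOfSurjective hg).symm.toLinearMap)
    ext x
    have := LinearMap.congr_fun h0 (g x)
    have hs : (g.quotKerEquivOfSurjective hg).symm (g x) = Submodule.Quotient.mk x := by
      rw [LinearEquiv.symm_apply_eq]; rfl
    simpa [hs] using this

/-- An extension of `D` by a module filtered by `Δ ν`, `ν ∈ S`, splits if `D` has a projective
presentation whose kernel is filtered by modules `Δ κ` without nonzero maps to the `Δ ν`. -/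
theorem exists_section {T : Set Λ} {Q D N M : Type} [AddCommGroup Q] [Module A Q]
    [AddCommGroup D] [Module A D] [Module.Projective A Q] [AddCommGroup N] [Module A N]
    [AddCommGroup M] [Module A M] {p : Q →ₗ[A] D} (hp : Function.Surjective p)
    (hK : DeltaFiltered A Δ T (LinearMap.ker p)) (hN : DeltaFiltered A Δ S N)
    (hTS : ∀ κ ∈ T, ∀ ν ∈ S, ∀ f : Δ κ →ₗ[A] Δ ν, f = 0)
    {f : N →ₗ[A] M} {g : M →ₗ[A] D} (hf : Function.Injective f) (hfg : Function.Exact f g)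
    (hg : Function.Surjective g) : ∃ s : D →ₗ[A] M, g ∘ₗ s = LinearMap.id := by
  obtain ⟨q, hq⟩ := Module.projective_lifting_property g p hg
  have hqk : LinearMap.ker p ≤ LinearMap.ker q := by
    have hN' := hN.of_equiv (LinearEquiv.ofInjective f hf)
    have hz := hK.hom_from_eq_zero (fun κ hκ => hN'.hom_to_eq_zero (hTS κ hκ))
      ((q ∘ₗ (LinearMap.ker p).subtype).codRestrict (LinearMap.range f) fun x =>
        (hfg _).1 ((LinearMap.congr_fun hq x.1).trans x.2))
    intro x hx
    exact congrArg Subtype.val (LinearMap.congr_fun hz ⟨x, hx⟩)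
  refine ⟨(LinearMap.ker p).liftQ q hqk ∘ₗ (p.quotKerEquivOfSurjective hp).symm.toLinearMap, ?_⟩
  ext d
  obtain ⟨x, rfl⟩ := hp d
  have hs : (p.quotKerEquivOfSurjective hp).symm (p x) = Submodule.Quotient.mk x := by
    rw [LinearEquiv.symm_apply_eq]; rfl
  simpa [hs] using LinearMap.congr_fun hq x

theorem range_le_trace {N M Y : Type} [AddCommGroup N] [Module A N] [AddCommGroup M] [Module A M]
    [AddCommGroup Y] [Module A Y] {P : Λ → Type} [∀ l, AddCommGroup (P l)]
    [∀ l, Module A (P l)] [∀ l, Module.Projective A (P l)] (p : ∀ l, P l →ₗ[A] Δ l)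
    (hp : ∀ l, Function.Surjective (p l)) (hN : DeltaFiltered A Δ S N)
    (hY : ∀ ν ∈ S, ∀ q : P ν →ₗ[A] M, LinearMap.range q ≤ traceModule (A := A) (Y := Y))
    (h : N →ₗ[A] M) : LinearMap.range h ≤ traceModule (A := A) (Y := Y) := by
  induction hN with
  | zero _ hs =>
    rintro _ ⟨x, rfl⟩
    rw [Subsingleton.elim x 0, map_zero]
    exact zero_mem _
  | extension N M ν hν f g hf hfg hg hN ih =>
    rintro _ ⟨x, rfl⟩
    obtain ⟨q, hq⟩ := Module.projective_lifting_property g (p ν) hg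
    obtain ⟨y, hy⟩ := hp ν (g x)
    obtain ⟨z, hz⟩ := (hfg (x - q y)).1 (by
      rw [map_sub, ← hy, ← hq, LinearMap.comp_apply, sub_self])
    rw [← sub_add_cancel x (q y), ← hz, map_add]
    exact add_mem (ih (h ∘ₗ f) ⟨z, rfl⟩) (hY ν hν (h ∘ₗ q) ⟨y, rfl⟩)

/-- If the modules `Δ ν`, `ν ∈ S ∩ U`, have no nontrivial extensions by modules filtered by
`Δ κ`, `κ ∈ S \ U`, then the sections indexed by `U` may be moved to the bottom. -/
theorem exists_submodule {U : Set Λ}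
    (hsplit : ∀ ν ∈ U, ∀ (N M : Type) [AddCommGroup N] [Module A N] [AddCommGroup M] [Module A M]
      (f : N →ₗ[A] M) (g : M →ₗ[A] Δ ν), Function.Injective f → Function.Exact f g →
      Function.Surjective g → DeltaFiltered A Δ (S \ U) N →
      ∃ s : Δ ν →ₗ[A] M, g ∘ₗ s = LinearMap.id)
    {M : Type} [AddCommGroup M] [Module A M] (hM : DeltaFiltered A Δ S M) :
    ∃ X : Submodule A M, DeltaFiltered A Δ (S ∩ U) X ∧ DeltaFiltered A Δ (S \ U) (M ⧸ X) := by
  induction hM with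
  | zero M h => exact ⟨⊥, .zero _ inferInstance, .zero _ inferInstance⟩
  | extension N M ν hν f g hf hfg hg hN ih =>
    obtain ⟨X, hX, hNX⟩ := ih
    have hXg : X.map f ≤ LinearMap.ker g := by
      rintro _ ⟨x, -, rfl⟩
      exact hfg.apply_apply_eq_zero x
    let f' : (N ⧸ X) →ₗ[A] (M ⧸ X.map f) := X.mapQ _ f (Submodule.le_comap_map _ _)
    let g' : (M ⧸ X.map f) →ₗ[A] Δ ν := (X.map f).liftQ g hXg
    have hf' : Function.Injective f' := by
      rw [injective_iff_map_eq_zero]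
      intro x hx
      obtain ⟨n, rfl⟩ := X.mkQ_surjective x
      obtain ⟨y, hy, hyn⟩ := (Submodule.Quotient.mk_eq_zero _).1 hx
      rw [← hf hyn]
      exact (Submodule.Quotient.mk_eq_zero _).2 hy
    have hfg' : Function.Exact f' g' := by
      intro y
      obtain ⟨m, rfl⟩ := (X.map f).mkQ_surjective y
      constructor
      · intro hm
        obtain ⟨n, rfl⟩ := (hfg m).1 hm
        exact ⟨X.mkQ n, rfl⟩
      · rintro ⟨x, hx⟩
        obtain ⟨n, rfl⟩ := X.mkQ_surjective x
        rw [← hx]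
        exact hfg.apply_apply_eq_zero n
    have hg' : Function.Surjective g' := fun d => by
      obtain ⟨m, rfl⟩ := hg d
      exact ⟨(X.map f).mkQ m, rfl⟩
    by_cases hU : ν ∈ U
    · obtain ⟨s, hs⟩ := hsplit ν hU _ _ f' g' hf' hfg' hg' hNX
      have hgs : ∀ d m, s d = (X.map f).mkQ m → g m = d := fun d m h => by
        have h1 : g' (s d) = d := LinearMap.congr_fun hs d
        rw [h] at h1
        exact h1
      let X' : Submodule A M := (LinearMap.range s).comap (X.map f).mkQ
      have hXX' : ∀ m ∈ X', g m = 0 → m ∈ X.map f := by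
        rintro m ⟨d, hd⟩ hm
        rw [hgs d m hd] at hm
        rw [hm, map_zero] at hd
        exact (Submodule.Quotient.mk_eq_zero _).1 hd.symm
      have hle : X.map f ≤ X' := fun m hm =>
        ⟨0, by rw [map_zero]; exact ((Submodule.Quotient.mk_eq_zero _).2 hm).symm⟩
      have hfX' : X ≤ X'.comap f := Submodule.map_le_iff_le_comap.1 hle
      refine ⟨X', .extension X X' ν ⟨hν, hU⟩ (f.restrict hfX') (g ∘ₗ X'.subtype) ?_ ?_ ?_ hX,
        hNX.of_equiv (LinearEquiv.ofBijective (X.mapQ X' f hfX') ⟨?_, ?_⟩)⟩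
      · intro x y hxy
        exact Subtype.ext (hf (congrArg Subtype.val hxy))
      · rintro ⟨m, hm⟩
        constructor
        · intro h
          obtain ⟨x, hx, rfl⟩ := hXX' m hm h
          exact ⟨⟨x, hx⟩, rfl⟩
        · rintro ⟨x, hx⟩
          rw [← hx]
          exact hfg.apply_apply_eq_zero x.1
      · intro d
        obtain ⟨m, hm⟩ := (X.map f).mkQ_surjective (s d)
        exact ⟨⟨m, d, hm.symm⟩, hgs d m hm.symm⟩
      · rw [injective_iff_map_eq_zero]
        intro x hx
        obtain ⟨n, rfl⟩ := X.mkQ_surjective x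
        obtain ⟨y, hy, hyn⟩ := hXX' _ ((Submodule.Quotient.mk_eq_zero _).1 hx)
          (hfg.apply_apply_eq_zero n)
        rw [← hf hyn]
        exact (Submodule.Quotient.mk_eq_zero _).2 hy
      · intro y
        obtain ⟨m, rfl⟩ := X'.mkQ_surjective y
        obtain ⟨m', hm'⟩ := (X.map f).mkQ_surjective (s (g m))
        obtain ⟨n, hn⟩ := (hfg (m - m')).1 (by rw [map_sub, hgs _ _ hm'.symm, sub_self])
        refine ⟨X.mkQ n, (Submodule.Quotient.eq _).2 ?_⟩
        rw [hn, sub_sub_cancel_left]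
        exact neg_mem ⟨_, hm'.symm⟩
    · refine ⟨X.map f, ?_, .extension _ _ ν ⟨hν, hU⟩ f' g' hf' hfg' hg' hNX⟩
      exact hX.of_equiv (X.equivMapOfInjective f hf)

theorem exists_directSum_equiv
    (hsplit : ∀ ν ∈ S, ∀ (N M : Type) [AddCommGroup N] [Module A N] [AddCommGroup M] [Module A M]
      (f : N →ₗ[A] M) (g : M →ₗ[A] Δ ν), Function.Injective f → Function.Exact f g →
      Function.Surjective g → DeltaFiltered A Δ S N → ∃ s : Δ ν →ₗ[A] M, g ∘ₗ s = LinearMap.id)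
    {M : Type} [AddCommGroup M] [Module A M] (hM : DeltaFiltered A Δ S M) :
    ∃ (ι : Type) (_ : Fintype ι) (g : ι → Λ), (∀ t, g t ∈ S) ∧
      Nonempty (M ≃ₗ[A] ⨁ t : ι, Δ (g t)) := by
  induction hM with
  | zero M h =>
    exact ⟨Empty, inferInstance, Empty.elim, fun t => t.elim,
      ⟨LinearEquiv.ofSubsingleton _ _⟩⟩
  | extension N M ν hν f g hf hfg hg hN ih =>
    obtain ⟨ι, _, γ, hγ, ⟨e⟩⟩ := ih
    obtain ⟨s, hs⟩ := hsplit ν hν _ _ f g hf hfg hg hN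
    have hgs : ∀ d, g (s d) = d := LinearMap.congr_fun hs
    let γ' : Option ι → Λ := fun t => t.elim ν γ
    refine ⟨Option ι, inferInstance, γ', ?_, ⟨?_⟩⟩
    · rintro (_ | t)
      exacts [hν, hγ t]
    · let φ : (Δ ν × N) ≃ₗ[A] M := LinearEquiv.ofBijective (s.coprod f) (by
        constructor
        · rw [injective_iff_map_eq_zero]
          rintro ⟨d, n⟩ h
          replace h : s d + f n = 0 := h
          have hd : d = 0 := by
            have := congrArg g h
            rwa [map_add, hgs, hfg.apply_apply_eq_zero, add_zero, map_zero] at this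
          rw [hd, map_zero, zero_add] at h
          rw [hd, (map_eq_zero_iff f hf).1 h]
          rfl
        · intro m
          obtain ⟨n, hn⟩ := (hfg (m - s (g m))).1 (by rw [map_sub, hgs, sub_self])
          refine ⟨(g m, n), ?_⟩
          rw [LinearMap.coprod_apply, hn, add_sub_cancel])
      exact φ.symm.trans ((LinearEquiv.prodCongr (LinearEquiv.refl A (Δ ν)) e).trans
        (DirectSum.lequivProdDirectSum A (α := fun t => Δ (γ' t))).symm)

end DeltaFiltered

end DeltaFiltration

theorem range_le_traceModule_directSum {A M ι : Type} [Ring A] [AddCommGroup M] [Module A M]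
    {P : ι → Type} [∀ i, AddCommGroup (P i)] [∀ i, Module A (P i)] (i : ι) (q : P i →ₗ[A] M) :
    LinearMap.range q ≤ traceModule (A := A) (Y := ⨁ i, P i) := by
  classical
  refine le_trans ?_ (le_iSup _ (q ∘ₗ DirectSum.component A ι P i))
  rintro _ ⟨y, rfl⟩
  exact ⟨DirectSum.lof A ι P i y, by simp [DirectSum.component.lof_self]⟩

theorem traceModule_directSum_le {A M ι : Type} [Ring A] [AddCommGroup M] [Module A M]
    {P : ι → Type} [∀ i, AddCommGroup (P i)] [∀ i, Module A (P i)] {X : Submodule A M}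
    (h : ∀ i (q : P i →ₗ[A] M), LinearMap.range q ≤ X) :
    traceModule (A := A) (Y := ⨁ i, P i) ≤ X := by
  classical
  refine iSup_le fun f => ?_
  rintro _ ⟨y, rfl⟩
  induction y using DirectSum.induction_on with
  | zero => rw [map_zero]; exact zero_mem _
  | of i y => exact h i (f ∘ₗ DirectSum.lof A ι P i) ⟨y, rfl⟩
  | add x y hx hy => rw [map_add]; exact add_mem hx hy

/-- Given a stratifying system and a height function, the trace filtration
`P(λ)_j = trace_{P(λ)}(⊕_{ht μ ≥ j} P(μ))` is decreasing, with sections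
`P(λ)_j / P(λ)_{j+1}` isomorphic to direct sums of modules `Δ(μ)` with `ht μ = j`. -/
theorem trace_filtration_of_projectives
    (𝒦 : Type) [CommRing 𝒦] [IsNoetherianRing 𝒦]
    (A : Type) [Ring A] [Algebra 𝒦 A] [Module.Finite 𝒦 A] [Module.Projective 𝒦 A]
    (Λ : Type) [Fintype Λ] (le : Λ → Λ → Prop)
    (hrefl : ∀ l, le l l) (htrans : ∀ {a b c}, le a b → le b c → le a c)
    (Δ : Λ → Type) [∀ l, AddCommGroup (Δ l)] [∀ l, Module A (Δ l)]
    [∀ l, Module 𝒦 (Δ l)] [∀ l, IsScalarTower 𝒦 A (Δ l)]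
    [∀ l, Module.Finite A (Δ l)] [∀ l, Module.Projective 𝒦 (Δ l)]
    (P : Λ → Type) [∀ l, AddCommGroup (P l)] [∀ l, Module A (P l)]
    [∀ l, Module.Finite A (P l)] [∀ l, Module.Projective A (P l)]
    (π : ∀ l, P l →ₗ[A] Δ l) (hπ : ∀ l, Function.Surjective (π l))
    (hSS1 : ∀ l m, (∃ f : P l →ₗ[A] Δ m, f ≠ 0) → le l m)
    (hSS2 : ∀ (L : Type) [AddCommGroup L] [Module A L], IsSimpleModule A L →
      ∃ (l : Λ) (f : Δ l →ₗ[A] L), Function.Surjective f)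
    (hSS3 : ∀ l : Λ, ∃ (n : ℕ) (F : ℕ → Submodule A (P l)) (μ : ℕ → Λ),
      F 0 = ⊥ ∧ F (n + 1) = ⊤ ∧ (∀ i, F i ≤ F (i + 1)) ∧
      Nonempty (SubSection (F n) (F (n + 1)) ≃ₗ[A] Δ l) ∧
      (∀ i < n, QLt le l (μ i) ∧ Nonempty (SubSection (F i) (F (i + 1)) ≃ₗ[A] Δ (μ i))))
    -- the height function
    (ht : Λ → ℤ)
    (hht_lt : ∀ {a b}, QLt le a b → ht a < ht b)
    (hht_sim : ∀ {a b}, le a b → le b a → ht a = ht b)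
    (l : Λ) :
    -- with `P(λ)_j := trace_{P(λ)} (⊕_{ht μ ≥ j} P(μ))` :
    (∀ j : ℤ,
      (traceModule (A := A) (Y := ⨁ m : {m : Λ // j + 1 ≤ ht m}, P m.1) (X := P l)) ≤
      (traceModule (A := A) (Y := ⨁ m : {m : Λ // j ≤ ht m}, P m.1) (X := P l))) ∧
    (∀ j : ℤ, ∃ (ι : Type) (_ : Fintype ι) (g : ι → Λ), (∀ t, ht (g t) = j) ∧
      Nonempty
        ((SubSection
            (traceModule (A := A) (Y := ⨁ m : {m : Λ // j + 1 ≤ ht m}, P m.1) (X := P l))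
            (traceModule (A := A) (Y := ⨁ m : {m : Λ // j ≤ ht m}, P m.1) (X := P l)))
          ≃ₗ[A] ⨁ t : ι, Δ (g t))) := by
  constructor
  · intro j
    refine traceModule_directSum_le fun i q => ?_
    exact range_le_traceModule_directSum (P := fun m : {m : Λ // j ≤ ht m} => P m.1)
      ⟨i.1, (Int.le_add_one le_rfl).trans i.2⟩ q
  intro j
  have hmono : ∀ {a b}, le a b → ht a ≤ ht b := fun {a b} hab => by
    by_cases hba : le b a
    · exact (hht_sim hab hba).le
    · exact (hht_lt ⟨hab, hba⟩).le
  have hPΔ : ∀ a b, ht b < ht a → ∀ f : P a →ₗ[A] Δ b, f = 0 := fun a b hab f => by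
    by_contra hf
    exact absurd (hmono (hSS1 a b ⟨f, hf⟩)) hab.not_ge
  have hcover : ∀ ν, ∃ p : P ν →ₗ[A] Δ ν, Function.Surjective p ∧
      DeltaFiltered A Δ {κ | QLt le ν κ} (LinearMap.ker p) ∧
      DeltaFiltered A Δ Set.univ (P ν) := by
    intro ν
    obtain ⟨n, F, μ, h0, h1, hF, ⟨e⟩, hsec⟩ := hSS3 ν
    have hn := DeltaFiltered.of_filtration (S := {κ | QLt le ν κ}) h0 hF hsec
    let t : P ν →ₗ[A] F (n + 1) := LinearMap.id.codRestrict _ fun x => h1 ▸ Submodule.mem_top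
    have hker : LinearMap.ker (e.toLinearMap ∘ₗ Submodule.mkQ _ ∘ₗ t) = F n := by
      ext x
      simp [t]
    have hsurj : Function.Surjective (e.toLinearMap ∘ₗ Submodule.mkQ _ ∘ₗ t) :=
      e.surjective.comp ((Submodule.mkQ_surjective _).comp fun x => ⟨x.1, rfl⟩)
    refine ⟨_, hsurj, by rw [hker]; exact hn, ?_⟩
    refine .extension (F n) (P ν) ν trivial (F n).subtype _ (F n).injective_subtype
      (fun x => ?_) hsurj (DeltaFiltered.of_filtration h0 hF fun i hi => ⟨trivial, (hsec i hi).2⟩)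
    rw [← LinearMap.mem_ker, hker]
    simp
  choose p hp hpker hpfilt using hcover
  have hsplit : ∀ (S : Set Λ) ν, (∀ κ ∈ S, ht κ ≤ ht ν) → ∀ (N M : Type) [AddCommGroup N]
      [Module A N] [AddCommGroup M] [Module A M] (f : N →ₗ[A] M) (g : M →ₗ[A] Δ ν),
      Function.Injective f → Function.Exact f g → Function.Surjective g →
      DeltaFiltered A Δ S N → ∃ s : Δ ν →ₗ[A] M, g ∘ₗ s = LinearMap.id := by
    intro S ν hS N M _ _ _ _ f g hf hfg hg hN
    refine DeltaFiltered.exists_section (hp ν) (hpker ν) hN (fun κ hκ b hb h => ?_) hf hfg hg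
    have h0 := hPΔ κ b ((hS b hb).trans_lt (hht_lt hκ)) (h ∘ₗ p κ)
    ext x
    obtain ⟨y, rfl⟩ := hp κ x
    exact LinearMap.congr_fun h0 y
  have hsub : ∀ (S : Set Λ) (k : ℤ) (M : Type) [AddCommGroup M] [Module A M],
      DeltaFiltered A Δ S M → ∃ X : Submodule A M,
        DeltaFiltered A Δ (S ∩ {ν | k ≤ ht ν}) X ∧ DeltaFiltered A Δ (S \ {ν | k ≤ ht ν}) (M ⧸ X) :=
    fun S k M _ _ hM => DeltaFiltered.exists_submodule (fun ν hν => hsplit _ ν fun κ hκ =>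
      (not_le.1 hκ.2).le.trans hν) hM
  have hland : ∀ (S : Set Λ) (k : ℤ) (M : Type) [AddCommGroup M] [Module A M]
      (X : Submodule A M), DeltaFiltered A Δ (S \ {ν | k ≤ ht ν}) (M ⧸ X) → ∀ m, k ≤ ht m →
      ∀ (q : P m →ₗ[A] M) (x : P m), q x ∈ X := by
    intro S k M _ _ X hX m hm q x
    have := hX.hom_to_eq_zero (fun ν hν => hPΔ m ν ((not_le.1 hν.2).trans_le hm)) (X.mkQ ∘ₗ q)
    exact (Submodule.Quotient.mk_eq_zero _).1 (LinearMap.congr_fun this x)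
  have htrace : ∀ (S : Set Λ) (k : ℤ) (X : Submodule A (P l)),
      DeltaFiltered A Δ (S ∩ {ν | k ≤ ht ν}) X →
      (∀ m, k ≤ ht m → ∀ (q : P m →ₗ[A] P l) (x : P m), q x ∈ X) →
      traceModule (A := A) (Y := ⨁ m : {m : Λ // k ≤ ht m}, P m.1) = X := by
    intro S k X hX hq
    apply le_antisymm
    · refine traceModule_directSum_le fun i q => ?_
      rintro _ ⟨x, rfl⟩
      exact hq i.1 i.2 q x
    · have := hX.range_le_trace p hp (Y := ⨁ m : {m : Λ // k ≤ ht m}, P m.1)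
        (fun ν hν q => range_le_traceModule_directSum
          (P := fun m : {m : Λ // k ≤ ht m} => P m.1) ⟨ν, hν.2⟩ q) X.subtype
      rwa [Submodule.range_subtype] at this
  obtain ⟨X, hX, hPX⟩ := hsub _ j _ (hpfilt l)
  obtain ⟨X', hX', hXX'⟩ := hsub _ (j + 1) _ hX
  have hXland := hland _ _ _ _ hPX
  have hXeq := htrace _ _ X hX hXland
  have hX'eq := htrace _ _ (X'.map X.subtype)
    (hX'.of_equiv (X'.equivMapOfInjective X.subtype X.injective_subtype)) fun m hm q x =>
      ⟨_, hland _ _ _ _ hXX' m hm (q.codRestrict X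
        (hXland m ((Int.le_add_one le_rfl).trans hm) q)) x, rfl⟩
  have hheight : ∀ κ ∈ (Set.univ ∩ {ν | j ≤ ht ν}) \ {ν | j + 1 ≤ ht ν}, ht κ = j :=
    fun κ hκ => le_antisymm (Int.lt_add_one_iff.1 (not_le.1 hκ.2)) hκ.1.2
  obtain ⟨ι, hι, γ, hγ, ⟨e⟩⟩ := hXX'.exists_directSum_equiv fun ν hν =>
    hsplit _ ν fun κ hκ => ((hheight κ hκ).trans (hheight ν hν).symm).le
  refine ⟨ι, hι, γ, fun t => hheight _ (hγ t), ?_⟩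
  rw [hXeq, hX'eq]
  exact ⟨(Submodule.quotEquivOfEq _ _
    (Submodule.comap_map_eq_of_injective X.injective_subtype X')).trans e⟩
end

section
/- Let J be an idempotent two-sided ideal of a ring A (i.e., J² = J) which is projective as a left A-module, and let M and N be A/J-modules. Then for every integer n ≥ 0, restriction of scalars along the quotient map A → A/J (inflation) induces an isomorphism of abelian groups Ext^n_{A/J}(M, N) ≅ Ext^n_A(M, N). -/
open CategoryTheory

noncomputable section

/-- The `n`-th Ext group of two `R`-modules, as an abelian group (the underlying type of
the `ModuleCat ℤ`-valued derived functor `Ext` of `Hom`). -/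
abbrev ExtGrp (R : Type) [Ring R] (n : ℕ) (M N : Type) [AddCommGroup M] [Module R M]
    [AddCommGroup N] [Module R N] : Type :=
  ((Ext ℤ (ModuleCat R) n).obj (Opposite.op (ModuleCat.of R M))).obj (ModuleCat.of R N)

/-- Restriction of scalars (inflation) along the quotient map `A → A/J`, turning an
`A/J`-module into an `A`-module. -/
def inflateModule (A : Type) [Ring A] (J : TwoSidedIdeal A) (M : Type) [AddCommGroup M]
    [Module J.ringCon.Quotient M] : Module A M :=
  Module.compHom M (RingCon.mk' J.ringCon)

universe w v u u' v' w'

namespace CategoryTheory.ProjectiveResolution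

variable {C : Type u} [Category.{v} C] [Abelian C] [HasExt.{w} C] {X Y : C}

lemma extMk_eq_zero_iff_of_degree_zero (R : ProjectiveResolution X) (f : R.complex.X 0 ⟶ Y) (m : ℕ)
    (hm : 0 + 1 = m) (hf : R.complex.d m 0 ≫ f = 0) : R.extMk f m hm hf = 0 ↔ f = 0 := by
  refine ⟨fun h ↦ ?_, fun h ↦ by subst h; simp⟩
  rw [← R.extEquivCohomologyClass.apply_eq_iff_eq,
    extEquivCohomologyClass_extMk, extEquivCohomologyClass_zero,
    CochainComplex.HomComplex.CohomologyClass.mk_eq_zero_iff,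
    CochainComplex.HomComplex.Cocycle.toSingleMk_mem_coboundaries_iff _ _ _ _ _ 1 (by simp)] at h
  obtain ⟨g, hg⟩ := h
  have hz : Limits.IsZero (R.cochainComplex.X 1) :=
    CochainComplex.isZero_of_isStrictlyLE _ 0 _ (by lia)
  rw [hz.eq_of_src g 0, Limits.comp_zero] at hg
  rw [← cancel_epi (R.cochainComplexXIso (-(0 : ℕ)) 0 rfl).hom]
  simpa using hg.symm

lemma extMk_eq_zero_iff_exists_prev (R : ProjectiveResolution X) {n : ℕ}
    (f : R.complex.X n ⟶ Y) (m : ℕ) (hm : n + 1 = m) (hf : R.complex.d m n ≫ f = 0) :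
    R.extMk f m hm hf = 0 ↔
      ∃ g : R.complex.X ((ComplexShape.up ℕ).prev n) ⟶ Y, R.complex.d n _ ≫ g = f := by
  cases n with
  | zero =>
    rw [R.extMk_eq_zero_iff_of_degree_zero, R.complex.shape _ _ (by simp)]
    simp [eq_comm]
  | succ n =>
    rw [R.extMk_eq_zero_iff _ _ _ _ n rfl, CochainComplex.prev_nat_succ]

variable (k : Type*) [Ring k] [Linear k C]

/-- The additive map which sends an `n`-cocycle of the cochain complex `Hom(R, Y)` attached to a
projective resolution `R` of `X` to its class in `Abelian.Ext X Y n`. -/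
def extOfCocycle (R : ProjectiveResolution X) (Y : C) (i n m : ℕ) (hm : n + 1 = m) :
    LinearMap.ker ((R.complex.linearYonedaObj k Y).sc' i n m).g.hom →+ Abelian.Ext X Y n :=
  AddMonoidHom.mk' (fun f ↦ R.extMk (Y := Y) f.1 m hm f.2) fun f g ↦
    (R.add_extMk (Y := Y) f.1 g.1 m hm f.2 g.2).symm

variable [EnoughProjectives C]

/-- The left derived functors of `Hom(-, Y)` agree with the `Ext`-groups of the derived category. -/
theorem nonempty_ext_addEquiv_abelianExt (X Y : C) (n : ℕ) :
    Nonempty (((Ext k C n).obj (Opposite.op X)).obj Y ≃+ Abelian.Ext X Y n) := by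
  let R := ProjectiveResolution.of X
  let K := R.complex.linearYonedaObj k Y
  let i := (ComplexShape.up ℕ).prev n
  let e : ((Ext k C n).obj (Opposite.op X)).obj Y ≅ _ :=
    R.isoExt n Y ≪≫ K.homologyIsoSc' i n (n + 1) rfl (by simp) ≪≫
      (K.sc' i n (n + 1)).moduleCatHomologyIso
  let φ := R.extOfCocycle k Y i n (n + 1) rfl
  have hφ : Function.Surjective φ := fun α ↦ by
    obtain ⟨f, hf, h⟩ := R.extMk_surjective α (n + 1) rfl
    exact ⟨⟨f, hf⟩, h⟩
  have hker : (LinearMap.range (K.sc' i n (n + 1)).moduleCatToCycles).toAddSubgroup = φ.ker := by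
    ext ⟨f, hf⟩
    refine Iff.trans ?_ (R.extMk_eq_zero_iff_exists_prev (Y := Y) f (n + 1) rfl hf).symm
    exact exists_congr fun g ↦ Subtype.ext_iff
  exact ⟨e.toLinearEquiv.toAddEquiv.trans
    ((QuotientAddGroup.quotientAddEquivOfEq hker).trans
      (QuotientAddGroup.quotientKerEquivOfSurjective φ hφ))⟩

end CategoryTheory.ProjectiveResolution

namespace CategoryTheory

open Limits Abelian

variable {C : Type u} [Category.{v} C] [Abelian C]
variable {D : Type u'} [Category.{v'} D] [Abelian D]

variable (F : C ⥤ D) [F.Additive] [PreservesFiniteLimits F] [PreservesFiniteColimits F]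

attribute [local simp] Ext.mapExactFunctor_comp Ext.mapExactFunctor_mk₀ Ext.mapExactFunctor_extClass

/-- A fully faithful exact functor `F` induces bijections `Ext X Y n → Ext (F X) (F Y) n` when `F`
sends projective objects to objects which are acyclic for `Hom(-, F Y)`. -/
lemma Functor.mapExt_bijective_of_acyclic [F.Full] [F.Faithful] [HasExt.{w} C]
    [HasExt.{w'} D] [EnoughProjectives C] (X Y : C) (hY : ∀ (P : C) [Projective P] (n : ℕ),
      Subsingleton (Abelian.Ext (F.obj P) (F.obj Y) (n + 1))) (n : ℕ) :
    Function.Bijective (F.mapExtAddHom X Y n) := by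
  induction n generalizing X with
  | zero => simpa [Ext.mapExactFunctor₀] using ⟨Faithful.map_injective, Full.map_surjective⟩
  | succ n hn =>
    let P : ProjectivePresentation X := Classical.arbitrary _
    let S := ShortComplex.mk _ _ (kernel.condition P.f)
    have : Subsingleton (Abelian.Ext (S.map F).X₂ (F.obj Y) (n + 1)) := hY P.p n
    have hS : S.ShortExact := { exact := ShortComplex.exact_kernel P.f }
    exact AddMonoidHom.bijective_of_surjective_of_bijective_of_right_exact _ _ _ _
      (F.mapExtAddHom S.X₂ Y n) (F.mapExtAddHom S.X₁ Y n) (F.mapExtAddHom S.X₃ Y (n + 1))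
      (by cat_disch) (by cat_disch)
      ((ShortComplex.ab_exact_iff_function_exact _).1
        (Ext.contravariant_sequence_exact₁' hS Y n (n + 1) (add_comm 1 n)))
      ((ShortComplex.ab_exact_iff_function_exact _).1
        (Ext.contravariant_sequence_exact₁' (hS.map F) (F.obj Y) n (n + 1) (add_comm 1 n)))
      (hn _).surjective (hn _)
      (fun x₃ ↦ Ext.contravariant_sequence_exact₃ hS _ x₃ (Ext.eq_zero_of_projective _) (add_comm 1 n))
      (fun y₃ ↦ Ext.contravariant_sequence_exact₃ (hS.map F) _ y₃ (Subsingleton.elim _ _) (add_comm 1 n))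

end CategoryTheory

namespace ModuleCat

open Limits

variable {A : Type u} {B : Type u'} [Ring A] [Ring B] (f : A →+* B)

lemma restrictScalars_map_exact' (S : ShortComplex (ModuleCat.{v} B)) (h : S.Exact) :
    (S.map (restrictScalars.{v} f)).Exact := by
  rw [ShortComplex.ShortExact.moduleCat_exact_iff_function_exact] at h ⊢
  exact h

lemma preservesFiniteLimits_restrictScalars : PreservesFiniteLimits (restrictScalars.{v} f) :=
  ((Functor.exact_tfae (restrictScalars.{v} f)).out 1 3 |>.mp (restrictScalars_map_exact' f) :
    PreservesFiniteLimits _ ∧ PreservesFiniteColimits _).1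

lemma preservesFiniteColimits_restrictScalars : PreservesFiniteColimits (restrictScalars.{v} f) :=
  ((Functor.exact_tfae (restrictScalars.{v} f)).out 1 3 |>.mp (restrictScalars_map_exact' f) :
    PreservesFiniteLimits _ ∧ PreservesFiniteColimits _).2

lemma restrictScalars_full (hf : Function.Surjective f) : (restrictScalars.{v} f).Full where
  map_surjective {X Y} g :=
    ⟨ofHom { toFun := fun x ↦ g.hom x
             map_add' := fun x y ↦ g.hom.map_add x y
             map_smul' := fun b x ↦ by
              obtain ⟨a, rfl⟩ := hf b
              exact g.hom.map_smul a x }, rfl⟩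

end ModuleCat

namespace ModuleCat

open Abelian

variable {A B : Type u} [Ring A] [Ring B] (f : A →+* B)

/-- If `f : A →+* B` is surjective with kernel `I`, this is the short exact sequence
`0 → I^(ι) → A^(ι) → B^(ι) → 0` of `A`-modules. -/
def finsuppShortComplex (ι : Type u) : ShortComplex (ModuleCat.{u} A) :=
  ShortComplex.mk
    (X₁ := of A (ι →₀ RingHom.ker f)) (X₂ := of A (ι →₀ A))
    (X₃ := (restrictScalars f).obj (of B (ι →₀ B)))
    (ofHom (Finsupp.mapRange.linearMap (RingHom.ker f).subtype))
    (ofHom (Y := (restrictScalars f).obj (of B (ι →₀ B)))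
      { toFun := Finsupp.mapRange f f.map_zero
        map_add' := Finsupp.mapRange_add f.map_add
        map_smul' := fun a x ↦ by
          refine Finsupp.ext fun i ↦ ?_
          exact f.map_mul a (x i) }) (by
      refine ModuleCat.hom_ext (LinearMap.ext fun x ↦ Finsupp.ext fun i ↦ ?_)
      exact ((show ι →₀ RingHom.ker f from x) i).2)

lemma finsuppShortComplex_shortExact (hf : Function.Surjective f) (ι : Type u) :
    (finsuppShortComplex f ι).ShortExact := by
  apply ModuleCat.shortComplex_shortExact
  · intro (x : ι →₀ A)
    constructor
    · intro hx
      have hx' (i : ι) : x i ∈ RingHom.ker f :=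
        DFunLike.congr_fun (show Finsupp.mapRange f f.map_zero x = 0 from hx) i
      refine ⟨Finsupp.onFinset x.support (fun i ↦ ⟨x i, hx' i⟩)
        (fun i hi ↦ Finsupp.mem_support_iff.2 fun h ↦ hi (Subtype.ext h)), ?_⟩
      exact Finsupp.ext fun i ↦ rfl
    · rintro ⟨y : ι →₀ RingHom.ker f, rfl⟩
      refine Finsupp.ext fun i ↦ ?_
      exact (y i).2
  · exact Finsupp.mapRange_injective _ rfl Subtype.val_injective
  · exact Finsupp.mapRange_surjective _ f.map_zero hf

lemma linearMap_eq_zero_of_isIdempotentElem {I : Ideal A} (hI : I * I = I) {N : Type*}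
    [AddCommGroup N] [Module A N] (hN : ∀ a ∈ I, ∀ x : N, a • x = 0) (g : I →ₗ[A] N) : g = 0 := by
  have h : I * I ≤ (LinearMap.ker g).map I.subtype := by
    refine Ideal.mul_le.2 fun r hr s hs ↦ ⟨r • ⟨s, hs⟩, ?_, rfl⟩
    exact (g.map_smul r ⟨s, hs⟩).trans (hN r hr _)
  rw [hI] at h
  ext ⟨x, hx⟩
  obtain ⟨y, hy, rfl⟩ := h hx
  exact hy

variable [Module.Projective A (RingHom.ker f)]

lemma subsingleton_ext_restrictScalars_finsupp (hf : Function.Surjective f)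
    (hidem : RingHom.ker f * RingHom.ker f = RingHom.ker f)
    (ι : Type u) (N : ModuleCat.{u} B) (n : ℕ) :
    Subsingleton (Ext ((restrictScalars f).obj (of B (ι →₀ B))) ((restrictScalars f).obj N)
      (n + 1)) := by
  have hS := finsuppShortComplex_shortExact f hf ι
  have h₁ : Projective (finsuppShortComplex f ι).X₁ :=
    (IsProjective.iff_projective (R := A) (ι →₀ RingHom.ker f)).1 <| by
      classical exact .of_equiv (finsuppLequivDFinsupp A).symm
  have h₂ : Projective (finsuppShortComplex f ι).X₂ :=
    (IsProjective.iff_projective (R := A) (ι →₀ A)).1 inferInstance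
  have h : Subsingleton (Ext (finsuppShortComplex f ι).X₁ ((restrictScalars f).obj N) n) := by
    cases n with
    | succ n => exact Ext.subsingleton_of_projective _ _ _
    | zero =>
      refine (Ext.homEquiv₀).subsingleton_congr.2 ⟨fun a b ↦ ?_⟩
      have key (g : (finsuppShortComplex f ι).X₁ ⟶ (restrictScalars f).obj N) : g = 0 := by
        refine ModuleCat.hom_ext (Finsupp.lhom_ext' fun i ↦ ?_)
        exact linearMap_eq_zero_of_isIdempotentElem hidem (N := (restrictScalars f).obj N)
          (fun a ha x ↦ (congrArg (· • (show (N : Type u) from x)) ha).trans (zero_smul B _)) _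
      rw [key a, key b]
  refine subsingleton_of_forall_eq 0 fun x ↦ ?_
  obtain ⟨y, rfl⟩ := Ext.contravariant_sequence_exact₃ hS _ x (Ext.eq_zero_of_projective _)
    (add_comm 1 n)
  rw [Subsingleton.elim y 0]
  exact Ext.comp_zero hS.extClass _ _ _ _

lemma subsingleton_ext_restrictScalars_of_projective (hf : Function.Surjective f)
    (hidem : RingHom.ker f * RingHom.ker f = RingHom.ker f)
    (P N : ModuleCat.{u} B) [Projective P] (n : ℕ) :
    Subsingleton (Ext ((restrictScalars f).obj P) ((restrictScalars f).obj N) (n + 1)) := by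
  have : Module.Projective B P := (IsProjective.iff_projective P).2 inferInstance
  obtain ⟨s, hs⟩ := Module.projective_def'.1 this
  let F := restrictScalars f
  have h : F.map (ofHom s) ≫ F.map (ofHom (Finsupp.linearCombination B id)) = 𝟙 (F.obj P) := by
    rw [← F.map_comp, ← ofHom_comp, hs]
    rfl
  have := subsingleton_ext_restrictScalars_finsupp f hf hidem P N n
  refine subsingleton_of_forall_eq 0 fun x ↦ ?_
  rw [← Ext.mk₀_id_comp x, ← h, ← Ext.mk₀_comp_mk₀,
    Ext.comp_assoc_of_second_deg_zero,
    Subsingleton.elim (Ext.comp (Ext.mk₀ (F.map _)) x _) 0,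
    Ext.comp_zero]

/-- Restriction of scalars along a surjective ring homomorphism whose kernel is idempotent and
projective as a left module preserves `Ext`-groups. -/
theorem nonempty_ext_addEquiv_restrictScalars (hf : Function.Surjective f)
    (hidem : RingHom.ker f * RingHom.ker f = RingHom.ker f)
    (M N : ModuleCat.{u} B) (n : ℕ) :
    Nonempty (((_root_.Ext ℤ (ModuleCat.{u} B) n).obj (Opposite.op M)).obj N ≃+
      ((_root_.Ext ℤ (ModuleCat.{u} A) n).obj
        (Opposite.op ((restrictScalars f).obj M))).obj ((restrictScalars f).obj N)) := by
  have := preservesFiniteLimits_restrictScalars.{u} f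
  have := preservesFiniteColimits_restrictScalars.{u} f
  have := restrictScalars_full.{u} f hf
  obtain ⟨e₁⟩ := ProjectiveResolution.nonempty_ext_addEquiv_abelianExt ℤ M N n
  obtain ⟨e₂⟩ := ProjectiveResolution.nonempty_ext_addEquiv_abelianExt ℤ
    ((restrictScalars f).obj M) ((restrictScalars f).obj N) n
  exact ⟨e₁.trans ((AddEquiv.ofBijective _ ((restrictScalars f).mapExt_bijective_of_acyclic M N
    (fun P _ n ↦ subsingleton_ext_restrictScalars_of_projective f hf hidem P N n) n)).trans
      e₂.symm)⟩

end ModuleCat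

/-- **Statement 18.** Let `J` be an idempotent two-sided ideal of a ring `A` which is
projective as a left `A`-module, and let `M`, `N` be `A/J`-modules.  Then for every
`n ≥ 0` there is an isomorphism of abelian groups
`Ext^n_{A/J}(M, N) ≅ Ext^n_A(M, N)`, where on the right-hand side `M` and `N` are
regarded as `A`-modules by inflation along `A → A/J`. -/
theorem ext_quotient_iso_ext_of_idempotent_projective_ideal
    (A : Type) [Ring A] (J : TwoSidedIdeal A)
    (hidem : J.asIdeal * J.asIdeal = J.asIdeal)
    (hproj : Module.Projective A ↥J.asIdeal)
    (M N : Type) [AddCommGroup M] [Module J.ringCon.Quotient M]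
    [AddCommGroup N] [Module J.ringCon.Quotient N] :
    ∀ n : ℕ,
      Nonempty
        (ExtGrp J.ringCon.Quotient n M N ≃+
          @ExtGrp A _ n M N _ (inflateModule A J M) _ (inflateModule A J N)) := by
  intro n
  have hker : RingHom.ker (RingCon.mk' J.ringCon) = J.asIdeal :=
    Ideal.ext fun a ↦ RingCon.eq J.ringCon
  have : Module.Projective A (RingHom.ker (RingCon.mk' J.ringCon)) := by rwa [hker]
  exact ModuleCat.nonempty_ext_addEquiv_restrictScalars (RingCon.mk' J.ringCon)
    (RingCon.mk'_surjective J.ringCon) (by rw [hker, hidem])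
    (ModuleCat.of _ M) (ModuleCat.of _ N) n

end
end

section
/- Let J be an idempotent two-sided ideal of a ring A (i.e., J² = J) which is projective as a left A-module, and let N be an A-module with JN = 0. Then Hom_A(J, N) = 0 and Ext^n_A(A/J, N) = 0 for all n ≥ 1. -/
open CategoryTheory

noncomputable section

open Limits

namespace CategoryTheory.ShortComplex

universe v u

variable {C : Type u} [Category.{v} C] [Abelian C] (S : ShortComplex C)

/-- The two-term chain complex `⋯ ⟶ 0 ⟶ S.X₁ ⟶ S.X₂`, with `S.X₂` in degree zero. -/
def twoTermComplex : ChainComplex C ℕ :=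
  ChainComplex.augment ((ChainComplex.single₀ C).obj S.X₁)
    ((HomologicalComplex.singleObjXSelf (ComplexShape.down ℕ) 0 S.X₁).hom ≫ S.f)
    (by rw [HomologicalComplex.single_obj_d, zero_comp])

lemma twoTermComplex_d_one_zero :
    S.twoTermComplex.d 1 0 =
      (HomologicalComplex.singleObjXSelf (ComplexShape.down ℕ) 0 S.X₁).hom ≫ S.f := rfl

lemma isZero_twoTermComplex_X (n : ℕ) : IsZero (S.twoTermComplex.X (n + 2)) :=
  HomologicalComplex.isZero_single_obj_X (ComplexShape.down ℕ) 0 S.X₁ (n + 1) (by simp)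

lemma twoTermComplex_exactAt_succ [Mono S.f] (n : ℕ) : S.twoTermComplex.ExactAt (n + 1) := by
  cases n with
  | zero =>
    rw [HomologicalComplex.exactAt_iff' _ 2 1 0 (by simp) (by simp)]
    have : Mono (S.twoTermComplex.d 1 0) := by
      rw [twoTermComplex_d_one_zero]
      exact @mono_comp _ _ _ _ _ _ (inferInstanceAs
        (Mono (HomologicalComplex.singleObjXSelf (ComplexShape.down ℕ) 0 S.X₁).hom)) S.f _
    exact (exact_iff_mono _ ((S.isZero_twoTermComplex_X 0).eq_of_src _ _)).2 this
  | succ n => exact exact_of_isZero_X₂ _ (S.isZero_twoTermComplex_X n)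

/-- The augmentation of the two-term complex of `S` given by `S.g : S.X₂ ⟶ S.X₃`. -/
def twoTermComplexπ : S.twoTermComplex ⟶ (ChainComplex.single₀ C).obj S.X₃ :=
  (ChainComplex.toSingle₀Equiv _ _).symm
    ⟨S.g, (Category.assoc _ S.f S.g).trans (S.zero.symm ▸ comp_zero)⟩

lemma twoTermComplexπ_f_zero : S.twoTermComplexπ.f 0 = S.g :=
  ChainComplex.toSingle₀Equiv_symm_apply_f_zero (C := S.twoTermComplex) S.g _

variable {S}

/-- A short exact sequence whose first two terms are projective is a projective resolution
of its third term. -/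
def ShortExact.projectiveResolution (hS : S.ShortExact) [Projective S.X₁] [Projective S.X₂] :
    ProjectiveResolution S.X₃ where
  complex := S.twoTermComplex
  projective
    | 0 => inferInstanceAs (Projective S.X₂)
    | 1 => inferInstanceAs (Projective S.X₁)
    | n + 2 => (S.isZero_twoTermComplex_X n).projective
  π := S.twoTermComplexπ
  quasiIso := ⟨fun n => by
    have := hS.mono_f
    cases n with
    | zero =>
      rw [ChainComplex.quasiIsoAt₀_iff, quasiIso_iff_of_zeros' _ rfl rfl rfl]
      refine (exact_and_epi_g_iff_of_iso ?_).2 ⟨hS.exact, hS.epi_g⟩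
      exact isoMk (HomologicalComplex.singleObjXSelf (ComplexShape.down ℕ) 0 S.X₁)
        (Iso.refl _) (Iso.refl _)
        (Category.comp_id _).symm
        ((Category.id_comp S.g).trans
          ((Category.comp_id (S.twoTermComplexπ.f 0)).trans S.twoTermComplexπ_f_zero).symm)
    | succ n =>
      rw [quasiIsoAt_iff_exactAt' _ _ (ChainComplex.exactAt_succ_single_obj _ _)]
      exact S.twoTermComplex_exactAt_succ n⟩

end CategoryTheory.ShortComplex

/-- If every morphism from the `n`-th term of a projective resolution of `X` to `Y` vanishes,
then `Ext^n X Y` is zero. -/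
lemma CategoryTheory.ProjectiveResolution.isZero_Ext {R C : Type*} [Ring R] [Category* C]
    [Abelian C] [Linear R C] [EnoughProjectives C] {X : C} (P : ProjectiveResolution X)
    (Y : C) (n : ℕ) (h : ∀ f : P.complex.X n ⟶ Y, f = 0) :
    IsZero (((Ext R C n).obj (Opposite.op X)).obj Y) := by
  refine IsZero.of_iso ?_ (P.isoExt n Y)
  rw [← HomologicalComplex.exactAt_iff_isZero_homology, HomologicalComplex.exactAt_iff]
  refine ShortComplex.exact_of_isZero_X₂ _ ?_
  rw [IsZero.iff_id_eq_zero]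
  ext (x : _ ⟶ _)
  obtain rfl : x = 0 := h x
  rfl

/-- If `I` is an idempotent left ideal annihilating `N`, then every linear map `I → N` is zero. -/
lemma Ideal.linearMap_eq_zero_of_isIdempotentElem {A N : Type*} [Ring A] [AddCommGroup N]
    [Module A N] {I : Ideal A} (hI : I * I = I) (hN : ∀ x ∈ I, ∀ v : N, x • v = 0)
    (f : I →ₗ[A] N) : f = 0 := by
  have hle : I * I ≤ (LinearMap.ker f).map I.subtype :=
    Ideal.mul_le.2 fun a ha b hb =>
      ⟨a • ⟨b, hb⟩, by rw [SetLike.mem_coe, LinearMap.mem_ker, map_smul, hN a ha], rfl⟩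
  ext ⟨x, hx⟩
  obtain ⟨y, hy, rfl⟩ := hle (hI.symm ▸ hx)
  exact hy

/-- **Statement 19.** Let `J` be an idempotent two-sided ideal of a ring `A` which is
projective as a left `A`-module, and let `N` be an `A`-module with `J • N = 0`.  Then
`Hom_A(J, N) = 0` and `Ext^n_A(A/J, N) = 0` for all `n ≥ 1`.  (Here `A/J` denotes the
quotient of `A` by the left `A`-submodule `J`, an `A`-module.) -/
theorem hom_and_ext_vanish_of_idempotent_projective_ideal
    (A : Type) [Ring A] (J : TwoSidedIdeal A)
    (hidem : J.asIdeal * J.asIdeal = J.asIdeal)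
    (hproj : Module.Projective A ↥J.asIdeal)
    (N : Type) [AddCommGroup N] [Module A N]
    (hJN : ∀ x ∈ J.asIdeal, ∀ v : N, x • v = 0) :
    (∀ f : (↥J.asIdeal) →ₗ[A] N, f = 0) ∧
    (∀ n : ℕ, 1 ≤ n → Subsingleton (ExtGrp A n (A ⧸ J.asIdeal) N)) := by
  have hom_zero := Ideal.linearMap_eq_zero_of_isIdempotentElem (N := N) hidem hJN
  refine ⟨hom_zero, fun n hn => ?_⟩
  let S : ShortComplex (ModuleCat A) := ModuleCat.shortComplexOfCompEqZero
    J.asIdeal.subtype J.asIdeal.mkQ (LinearMap.exact_subtype_mkQ J.asIdeal).linearMap_comp_eq_zero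
  have hS : S.ShortExact := ModuleCat.shortComplex_shortExact S
    (LinearMap.exact_subtype_mkQ J.asIdeal) J.asIdeal.injective_subtype
    J.asIdeal.mkQ_surjective
  have : Projective S.X₁ := (IsProjective.iff_projective J.asIdeal).1 hproj
  have : Projective S.X₂ := (IsProjective.iff_projective A).1 inferInstance
  refine ModuleCat.subsingleton_of_isZero
    (hS.projectiveResolution.isZero_Ext (ModuleCat.of A N) n fun f => ?_)
  match n, hn with
  | 1, _ => exact ModuleCat.hom_ext (hom_zero (ModuleCat.Hom.hom f))
  | n + 2, _ => exact (S.isZero_twoTermComplex_X n).eq_of_src _ _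

end
end
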